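/- (Lemma 4.6, 1D case, d = 1.) Let u_h ∈ V^k, let U be a C^{k+1} periodic function on Ω, and set ξ = u_h − P*U. Assume ‖u_h − avg(u_h)‖_{L∞(Ω)} ≥ c₀ > 0, the partition is quasi-uniform, and the cell wave speeds satisfy 0 ≤ β_j ≤ β_max. Then there is a constant C = C(k, c₀, β_max, γ) such that the damping rates δ_j^m := β_j σ_j^m(u_h)/h_j satisfy, for all j and 0 ≤ m ≤ k, |δ_j^m| ≤ C ( h^{−3/2} ‖ξ‖_{L²(N_j)} + h^{k−1/2} ‖U‖_{H^{k+1}(N_j)} ), where N_j = I_{j−1} ∪ I_j ∪ I_{j+1}. -/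

import Mathlib

open Polynomial Finset MeasureTheory

namespace OEDG

variable {N : ℕ}

/-- `pt` lists the nodes `x_{1/2} < x_{3/2} < … < x_{N+1/2}` of a partition of `Ω = [0,1]`. -/
def IsMesh (pt : Fin (N+1) → ℝ) : Prop :=
  pt 0 = 0 ∧ pt (Fin.last N) = 1 ∧ StrictMono pt

/-- Left endpoint of cell `j`. -/
def ptL (pt : Fin (N+1) → ℝ) (j : Fin N) : ℝ := pt j.castSucc

/-- Right endpoint of cell `j`. -/
def ptR (pt : Fin (N+1) → ℝ) (j : Fin N) : ℝ := pt j.succ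

/-- Length `h_j` of cell `j`. -/
def cellh (pt : Fin (N+1) → ℝ) (j : Fin N) : ℝ := ptR pt j - ptL pt j

/-- Maximal mesh size `h`. -/
noncomputable def meshSize (pt : Fin (N+1) → ℝ) : ℝ := ⨆ j : Fin N, cellh pt j

/-- Quasi-uniformity of the partition: `h ≤ γ h_j` for all `j`. -/
def QuasiUniform (pt : Fin (N+1) → ℝ) (γ : ℝ) : Prop :=
  ∀ j : Fin N, meshSize pt ≤ γ * cellh pt j

/-- Membership in `V^k`: every cell polynomial has degree at most `k`. -/
def MemVk (k : ℕ) (u : Fin N → Polynomial ℝ) : Prop :=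
  ∀ j, (u j).natDegree ≤ k

/-- Cellwise `L²` inner product. -/
noncomputable def cip (pt : Fin (N+1) → ℝ) (j : Fin N) (p q : Polynomial ℝ) : ℝ :=
  ∫ x in (ptL pt j)..(ptR pt j), p.eval x * q.eval x

/-- Global `L²(Ω)` inner product of piecewise polynomials. -/
noncomputable def ip (pt : Fin (N+1) → ℝ) (u v : Fin N → Polynomial ℝ) : ℝ :=
  ∑ j : Fin N, cip pt j (u j) (v j)

/-- Cellwise `L²` norm. -/
noncomputable def cl2 (pt : Fin (N+1) → ℝ) (j : Fin N) (p : Polynomial ℝ) : ℝ :=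
  Real.sqrt (cip pt j p p)

/-- Global `L²(Ω)` norm of a piecewise polynomial. -/
noncomputable def l2 (pt : Fin (N+1) → ℝ) (u : Fin N → Polynomial ℝ) : ℝ :=
  Real.sqrt (ip pt u u)

/-- Average `avg(u) = (1/|Ω|) ∫_Ω u dx` (here `|Ω| = 1`). -/
noncomputable def avg (pt : Fin (N+1) → ℝ) (u : Fin N → Polynomial ℝ) : ℝ :=
  ∑ j : Fin N, ∫ x in (ptL pt j)..(ptR pt j), (u j).eval x

/-- `‖u - c‖_{L∞(Ω)}` for a piecewise polynomial `u` and a constant `c`. -/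
noncomputable def linfSub (pt : Fin (N+1) → ℝ) (u : Fin N → Polynomial ℝ) (c : ℝ) : ℝ :=
  ⨆ j : Fin N, sSup ((fun x => |(u j).eval x - c|) '' Set.Icc (ptL pt j) (ptR pt j))

/-- `m`-th derivative of a polynomial. -/
noncomputable def pderiv (m : ℕ) (p : Polynomial ℝ) : Polynomial ℝ :=
  (fun q : Polynomial ℝ => Polynomial.derivative q)^[m] p

/-- Jump `[∂_x^m u]_{j+1/2}` of the `m`-th derivative at the interface to the right of
cell `j`, with periodic identification of `x_{N+1/2}` with `x_{1/2}`. -/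
noncomputable def jumpD [NeZero N] (pt : Fin (N+1) → ℝ) (u : Fin N → Polynomial ℝ)
    (m : ℕ) (j : Fin N) : ℝ :=
  (pderiv m (u (j+1))).eval (pt (Fin.castSucc (j+1))) - (pderiv m (u j)).eval (pt j.succ)

/-- The scale-invariant damping coefficient `σ_j^m(u)` of the OEDG method. -/
noncomputable def sigma [NeZero N] (k : ℕ) (pt : Fin (N+1) → ℝ)
    (u : Fin N → Polynomial ℝ) (m : ℕ) (j : Fin N) : ℝ :=
  if ∀ i, u i = Polynomial.C (avg pt u) then 0
  else (2*(m:ℝ)+1) * (cellh pt j)^m / ((2*(k:ℝ)-1) * (Nat.factorial m)) *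
    ((|jumpD pt u m (j-1)| + |jumpD pt u m j|) / (2 * linfSub pt u (avg pt u)))

/-- Damping rate `δ_j^m = β_j σ_j^m(u) / h_j`. -/
noncomputable def dampRate [NeZero N] (k : ℕ) (pt : Fin (N+1) → ℝ) (β : Fin N → ℝ)
    (u : Fin N → Polynomial ℝ) (m : ℕ) (j : Fin N) : ℝ :=
  β j * sigma k pt u m j / cellh pt j

/-- `Pc j d` is the cellwise `L²(I_j)`-orthogonal projection onto `ℙ^d(I_j)`.
(The family `Pc` realizes the global projections `P^d` onto `V^d`.) -/
def IsCellProj (pt : Fin (N+1) → ℝ)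
    (Pc : Fin N → ℕ → Polynomial ℝ → Polynomial ℝ) : Prop :=
  ∀ (j : Fin N) (dd : ℕ) (p : Polynomial ℝ), (Pc j dd p).natDegree ≤ dd ∧
    ∀ q : Polynomial ℝ, q.natDegree ≤ dd → cip pt j (p - Pc j dd p) q = 0

/-- `w` solves the damping initial value problem with initial data `u`:
`d/dt̂ ∫_{I_j} u_σ v dx + ∑_{m=0}^k (β_j σ_j^m(u)/h_j) ∫_{I_j} (u_σ - P^{m-1} u_σ) v dx = 0`
for every `v ∈ ℙ^k(I_j)` and every `j`, with `u_σ(·,0) = u`.  (Note `m - 1` is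
truncated ℕ-subtraction, which realizes the convention `P^{-1} = P^0`.) -/
def IsDampingSol [NeZero N] (k : ℕ) (pt : Fin (N+1) → ℝ) (β : Fin N → ℝ)
    (Pc : Fin N → ℕ → Polynomial ℝ → Polynomial ℝ)
    (u : Fin N → Polynomial ℝ) (w : ℝ → Fin N → Polynomial ℝ) : Prop :=
  w 0 = u ∧ (∀ t j, (w t j).natDegree ≤ k) ∧
  ∀ (t : ℝ) (j : Fin N) (v : Polynomial ℝ), v.natDegree ≤ k →
    HasDerivAt (fun s => cip pt j (w s j) v)
      (-(∑ m ∈ Finset.range (k+1),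
        dampRate k pt β u m j * cip pt j (w t j - Pc j (m-1) (w t j)) v)) t

/-- `Fτ` is the OE (oscillation-eliminating) operator: for every `u ∈ V^k` the damping
initial value problem has a solution `w` and `Fτ u = w τ`. -/
def IsOEOp [NeZero N] (k : ℕ) (pt : Fin (N+1) → ℝ) (β : Fin N → ℝ)
    (Pc : Fin N → ℕ → Polynomial ℝ → Polynomial ℝ) (τ : ℝ)
    (Fτ : (Fin N → Polynomial ℝ) → (Fin N → Polynomial ℝ)) : Prop :=
  ∀ u, MemVk k u → ∃ w, IsDampingSol k pt β Pc u w ∧ Fτ u = w τ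

/-- Right-hand side of the weak form of the upwind DG operator for `u_t + β u_x = 0`:
`β ∫_{I_j} w v_x dx - β w(x_{j+1/2}^-) v(x_{j+1/2}^-) + β w(x_{j-1/2}^-) v(x_{j-1/2}^+)`. -/
noncomputable def dgRHS [NeZero N] (pt : Fin (N+1) → ℝ) (β : ℝ)
    (w : Fin N → Polynomial ℝ) (j : Fin N) (v : Polynomial ℝ) : ℝ :=
  β * (∫ x in (ptL pt j)..(ptR pt j), (w j).eval x * (Polynomial.derivative v).eval x)
  - β * (w j).eval (ptR pt j) * v.eval (ptR pt j)
  + β * (w (j-1)).eval (pt (j-1).succ) * v.eval (ptL pt j)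

/-- `L` is the upwind DG spatial operator on `V^k`. -/
def IsDGOp [NeZero N] (k : ℕ) (pt : Fin (N+1) → ℝ) (β : ℝ)
    (L : (Fin N → Polynomial ℝ) → (Fin N → Polynomial ℝ)) : Prop :=
  ∀ w, MemVk k w → MemVk k (L w) ∧
    ∀ (j : Fin N) (v : Polynomial ℝ), v.natDegree ≤ k →
      cip pt j (L w j) v = dgRHS pt β w j v

/-- The upwind DG bilinear form
`H(w,v) = β ∑_j ∫_{I_j} w v_x dx + β ∑_j w(x_{j+1/2}^-) [v]_{j+1/2}`. -/
noncomputable def Hform [NeZero N] (pt : Fin (N+1) → ℝ) (β : ℝ)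
    (w v : Fin N → Polynomial ℝ) : ℝ :=
  β * ∑ j : Fin N, (∫ x in (ptL pt j)..(ptR pt j),
      (w j).eval x * (Polynomial.derivative (v j)).eval x)
  + β * ∑ j : Fin N, (w j).eval (ptR pt j) * jumpD pt v 0 j

/-- The upwind DG bilinear form with piecewise-smooth first argument. -/
noncomputable def HformF [NeZero N] (pt : Fin (N+1) → ℝ) (β : ℝ)
    (w : Fin N → ℝ → ℝ) (v : Fin N → Polynomial ℝ) : ℝ :=
  β * ∑ j : Fin N, (∫ x in (ptL pt j)..(ptR pt j),
      w j x * (Polynomial.derivative (v j)).eval x)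
  + β * ∑ j : Fin N, w j (ptR pt j) * jumpD pt v 0 j

/-- `L²(Ω)` pairing of a piecewise-smooth function with a piecewise polynomial. -/
noncomputable def ipF (pt : Fin (N+1) → ℝ) (w : Fin N → ℝ → ℝ)
    (v : Fin N → Polynomial ℝ) : ℝ :=
  ∑ j : Fin N, ∫ x in (ptL pt j)..(ptR pt j), w j x * (v j).eval x

/-- One Runge–Kutta stage: `∑_{0≤m≤ℓ} (c_{ℓm} u_σ^{n,m} + τ d_{ℓm} L(u_σ^{n,m}))`. -/
noncomputable def rkStage [NeZero N] (c d : ℕ → ℕ → ℝ) (τ : ℝ)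
    (L : (Fin N → Polynomial ℝ) → (Fin N → Polynomial ℝ))
    (uσ : ℕ → Fin N → Polynomial ℝ) (ℓ : ℕ) : Fin N → Polynomial ℝ :=
  fun j => ∑ m ∈ Finset.range (ℓ+1),
    (Polynomial.C (c ℓ m) * uσ m j + Polynomial.C (τ * d ℓ m) * L (uσ m) j)

/-- One full OEDG time step from `u_σ^n = un`: the stages `u_h^{n,ℓ+1}` and
`u_σ^{n,ℓ+1} = F_τ u_h^{n,ℓ+1}`, `0 ≤ ℓ ≤ s-1`. -/
def IsOEDGStep [NeZero N] (s : ℕ) (c d : ℕ → ℕ → ℝ) (τ : ℝ)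
    (L Fτ : (Fin N → Polynomial ℝ) → (Fin N → Polynomial ℝ))
    (un : Fin N → Polynomial ℝ) (uh uσ : ℕ → Fin N → Polynomial ℝ) : Prop :=
  uσ 0 = un ∧ ∀ ℓ < s, uh (ℓ+1) = rkStage c d τ L uσ ℓ ∧ uσ (ℓ+1) = Fτ (uh (ℓ+1))

/-- The full OEDG evolution: `uσ n ℓ = u_σ^{n,ℓ}` and `uh n ℓ = u_h^{n,ℓ}`, starting from
`u_σ^0 = u0`, with `u_σ^{n+1} = u_σ^{n,s}`. -/
def IsOEDGEvol [NeZero N] (s : ℕ) (c d : ℕ → ℕ → ℝ) (τ : ℝ)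
    (L Fτ : (Fin N → Polynomial ℝ) → (Fin N → Polynomial ℝ))
    (u0 : Fin N → Polynomial ℝ) (uh uσ : ℕ → ℕ → Fin N → Polynomial ℝ) : Prop :=
  uσ 0 0 = u0 ∧ ∀ n, uσ (n+1) 0 = uσ n s ∧
    ∀ ℓ < s, uh n (ℓ+1) = rkStage c d τ L (uσ n) ℓ ∧ uσ n (ℓ+1) = Fτ (uh n (ℓ+1))

/-- `p` is the Gauss–Radau projection of `w` on `[a,b]` into `ℙ^k`:
`∫_a^b (w - p) q dx = 0` for all `q ∈ ℙ^{k-1}` and `p(b) = w(b)`. -/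
def IsGRProj (k : ℕ) (a b : ℝ) (w : ℝ → ℝ) (p : Polynomial ℝ) : Prop :=
  p.natDegree ≤ k ∧
  (∀ q : Polynomial ℝ, q.natDegree < k →
    (∫ x in a..b, (w x - p.eval x) * q.eval x) = 0) ∧
  p.eval b = w b

/-- `u = u(x,t)` is a smooth `1`-periodic exact solution of `u_t + β u_x = 0`. -/
def IsSmoothSolution (β : ℝ) (u : ℝ → ℝ → ℝ) : Prop :=
  ContDiff ℝ (⊤ : ℕ∞) (fun p : ℝ × ℝ => u p.1 p.2) ∧
  (∀ x t, u (x+1) t = u x t) ∧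
  (∀ x t, deriv (fun s => u x s) t + β * deriv (fun y => u y t) x = 0)

/-- Auxiliary table for the reference functions `U^{n,ℓ}`. -/
noncomputable def UrefUpTo (u : ℝ → ℝ → ℝ) (c d : ℕ → ℕ → ℝ) (β τ : ℝ) (n : ℕ) :
    ℕ → ℕ → ℝ → ℝ
  | 0 => fun _ => fun x => u x ((n:ℝ) * τ)
  | (ℓ+1) => fun i =>
      if i ≤ ℓ then UrefUpTo u c d β τ n ℓ i
      else fun x => ∑ m ∈ Finset.range (ℓ+1),
        (c ℓ m * UrefUpTo u c d β τ n ℓ m x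
          - τ * d ℓ m * β * deriv (UrefUpTo u c d β τ n ℓ m) x)

/-- Reference function `U^{n,ℓ}` (for `0 ≤ ℓ ≤ s-1`): `U^{n,0} = u(·, t^n)` and
`U^{n,ℓ+1} = ∑_{0≤m≤ℓ} (c_{ℓm} U^{n,m} - τ d_{ℓm} β ∂_x U^{n,m})`. -/
noncomputable def Uref (u : ℝ → ℝ → ℝ) (c d : ℕ → ℕ → ℝ) (β τ : ℝ) (n ℓ : ℕ) : ℝ → ℝ :=
  UrefUpTo u c d β τ n ℓ ℓ

/-- Reference function `U^{n,ℓ}` including the final stage `U^{n,s} := u(·, t^{n+1})`. -/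
noncomputable def UrefS (u : ℝ → ℝ → ℝ) (c d : ℕ → ℕ → ℝ) (β τ : ℝ) (s n ℓ : ℕ) : ℝ → ℝ :=
  if ℓ = s then fun x => u x (((n:ℝ)+1) * τ) else Uref u c d β τ n ℓ

/-- The Runge–Kutta residual `ρ^{n,s-1}`, defined so that
`U^{n,s} = ∑_{0≤m≤s-1} (c_{s-1,m} U^{n,m} - τ d_{s-1,m} β ∂_x U^{n,m}) + τ ρ^{n,s-1}`. -/
noncomputable def rkRes (u : ℝ → ℝ → ℝ) (c d : ℕ → ℕ → ℝ) (β τ : ℝ) (s n : ℕ) : ℝ → ℝ :=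
  fun x => (u x (((n:ℝ)+1) * τ) - ∑ m ∈ Finset.range s,
    (c (s-1) m * Uref u c d β τ n m x
      - τ * d (s-1) m * β * deriv (Uref u c d β τ n m) x)) / τ

/-- `L²(0,1)` norm of a function. -/
noncomputable def fl2 (f : ℝ → ℝ) : ℝ := Real.sqrt (∫ x in (0:ℝ)..1, (f x)^2)

/-- `L²(Ω)` distance between a piecewise polynomial and a function. -/
noncomputable def errL2 (pt : Fin (N+1) → ℝ) (w : Fin N → Polynomial ℝ) (f : ℝ → ℝ) : ℝ :=
  Real.sqrt (∑ j : Fin N, ∫ x in (ptL pt j)..(ptR pt j), ((w j).eval x - f x)^2)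



lemma exists_derivative_bound_unit (k : ℕ) : ∃ C : ℝ, 0 < C ∧ ∀ p : ℝ[X], p.natDegree ≤ k →
    ∀ m ≤ k, ∀ x ∈ Set.Icc (0:ℝ) 1,
      (derivative^[m] p).eval x ^ 2 ≤ C * ∫ t in (0:ℝ)..1, (1 - t) * p.eval t ^ 2 := by
  set q : (Fin (k+1) → ℝ) → ℝ[X] := fun c => ∑ i, C (c i) * X ^ (i : ℕ) with hq
  have hqe : ∀ c t, (q c).eval t = ∑ i, c i * t ^ (i : ℕ) := by
    intro c t; simp [hq, eval_finsetSum]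
  set F : (Fin (k+1) → ℝ) → ℝ := fun c => ∫ t in (0:ℝ)..1, (1 - t) * (q c).eval t ^ 2 with hF
  have hFc : Continuous F := by
    apply intervalIntegral.continuous_parametric_intervalIntegral_of_continuous'
    simp only [Function.uncurry_def, hqe]
    fun_prop
  have hpos : ∀ c, c ≠ 0 → 0 < F c := by
    intro c hc
    have hq0 : q c ≠ 0 := by
      intro h
      apply hc
      ext i
      have := congrArg (fun p => coeff p (i : ℕ)) h
      simpa [hq, finsetSum_coeff, coeff_X_pow, Fin.val_inj] using this
    have hr : (((C 1 - X) * q c ^ 2 : ℝ[X])) ≠ 0 := by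
      refine mul_ne_zero ?_ (pow_ne_zero _ hq0)
      intro h
      have := congrArg (eval 0) h
      simp at this
    have hinf : (Set.Ioo (0:ℝ) 1).Infinite := Set.Ioo_infinite one_pos
    obtain ⟨x, hx, hxr⟩ : ∃ x ∈ Set.Ioo (0:ℝ) 1, ((C 1 - X) * q c ^ 2 : ℝ[X]).eval x ≠ 0 := by
      by_contra! h
      exact hr (eq_zero_of_infinite_isRoot _ (hinf.mono fun x hx => h x hx))
    have hxr' : (1 - x) * (q c).eval x ^ 2 ≠ 0 := by simpa using hxr
    refine intervalIntegral.integral_pos one_pos ?_ ?_ ⟨x, Set.Ioo_subset_Icc_self hx, ?_⟩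
    · fun_prop
    · intro t ht
      have : 0 ≤ 1 - t := by linarith [ht.2]
      positivity
    · have : 0 ≤ 1 - x := by linarith [hx.2]
      exact lt_of_le_of_ne (by positivity) hxr'.symm
  obtain ⟨δ, hδ, hmin⟩ : ∃ δ > 0, ∀ c, ‖c‖ = 1 → δ ≤ F c := by
    obtain ⟨c, hc, hm⟩ := (isCompact_sphere (0 : Fin (k+1) → ℝ) 1).exists_isMinOn
      (NormedSpace.sphere_nonempty.2 zero_le_one) hFc.continuousOn
    refine ⟨F c, hpos c ?_, fun c' hc' => hm (by simpa using hc')⟩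
    rintro rfl
    simp at hc
  have hcoer : ∀ c, δ * ‖c‖ ^ 2 ≤ F c := by
    intro c
    rcases eq_or_ne c 0 with rfl | hc
    · simp [hF, hqe]
    have hn : ‖c‖ ≠ 0 := norm_ne_zero_iff.2 hc
    have h1 := hmin (‖c‖⁻¹ • c) (by rw [norm_smul]; simp [hn])
    have h2 : F (‖c‖⁻¹ • c) = (‖c‖⁻¹) ^ 2 * F c := by
      simp only [hF, ← intervalIntegral.integral_const_mul]
      congr 1; ext t
      have : (q (‖c‖⁻¹ • c)).eval t = ‖c‖⁻¹ * (q c).eval t := by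
        simp [hqe, Finset.mul_sum, mul_assoc]
      rw [this]; ring
    rw [h2] at h1
    calc δ * ‖c‖ ^ 2 ≤ (‖c‖⁻¹ ^ 2 * F c) * ‖c‖ ^ 2 := by gcongr
      _ = F c := by field_simp
  set B : ℝ := ∑ m ∈ range (k+1), ∑ i : Fin (k+1), ((i : ℕ).descFactorial m : ℝ) with hB
  have hBm : ∀ m ≤ k, ∑ i : Fin (k+1), ((i : ℕ).descFactorial m : ℝ) ≤ B := fun m hm =>
    single_le_sum (f := fun m => ∑ i : Fin (k+1), ((i : ℕ).descFactorial m : ℝ))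
      (fun _ _ => by positivity) (mem_range.2 (by omega))
  refine ⟨(B ^ 2 + 1) / δ, by positivity, fun p hp m hm x hx => ?_⟩
  set c : Fin (k+1) → ℝ := fun i => p.coeff i with hc
  have hpq : p = q c := by
    conv_lhs => rw [p.as_sum_range_C_mul_X_pow' (Nat.lt_succ_of_le hp)]
    simp [hq, hc, Finset.sum_range]
  have hd : |(derivative^[m] p).eval x| ≤ B * ‖c‖ := by
    rw [hpq]
    simp only [hq, iterate_derivative_sum, iterate_derivative_C_mul,
      iterate_derivative_X_pow_eq_natCast_mul, eval_finsetSum]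
    refine (abs_sum_le_sum_abs _ _).trans ?_
    refine le_trans ?_ (mul_le_mul_of_nonneg_right (hBm m hm) (norm_nonneg _))
    rw [Finset.sum_mul]
    refine sum_le_sum fun i _ => ?_
    simp only [eval_mul, eval_C, eval_natCast, eval_pow, eval_X, abs_mul, Nat.abs_cast, abs_pow]
    have h1 : |c i| ≤ ‖c‖ := norm_le_pi_norm c i
    have h2 : |x| ^ ((i : ℕ) - m) ≤ 1 := pow_le_one₀ (abs_nonneg _) (by
      rw [abs_of_nonneg hx.1]; exact hx.2)
    calc _ ≤ ‖c‖ * (((i : ℕ).descFactorial m : ℝ) * 1) := by gcongr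
      _ = _ := by ring
  have h3 : (derivative^[m] p).eval x ^ 2 ≤ (B * ‖c‖) ^ 2 := by
    rw [← sq_abs]; gcongr
  have h4 := hcoer c
  simp only [hF] at h4
  rw [← hpq] at h4
  calc _ ≤ (B * ‖c‖) ^ 2 := h3
    _ ≤ (B ^ 2 + 1) / δ * (δ * ‖c‖ ^ 2) := by
      field_simp; nlinarith [sq_nonneg ‖c‖]
    _ ≤ _ := by gcongr

lemma iterate_derivative_comp_affine (p : ℝ[X]) (a h : ℝ) (m : ℕ) :
    derivative^[m] (p.comp (C a + C h * X)) =
      C (h ^ m) * (derivative^[m] p).comp (C a + C h * X) := by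
  induction m with
  | zero => simp
  | succ m ih =>
    rw [Function.iterate_succ_apply', ih, Function.iterate_succ_apply']
    simp only [derivative_C_mul, derivative_comp, derivative_add, derivative_C, derivative_X]
    rw [pow_succ, C_mul]
    ring

/-- Inverse inequality on `[a, b]`, with the weight `b - t` on the right-hand side. -/
lemma exists_inverse_inequality_weighted (k : ℕ) : ∃ K : ℝ, 0 < K ∧
    ∀ p : ℝ[X], p.natDegree ≤ k → ∀ a b : ℝ, a < b → ∀ m ≤ k, ∀ x ∈ Set.Icc a b,
      ((b - a) ^ m * (derivative^[m] p).eval x) ^ 2 * (b - a) ^ 2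
        ≤ K * ∫ t in a..b, (b - t) * p.eval t ^ 2 := by
  obtain ⟨K, hK, H⟩ := exists_derivative_bound_unit k
  refine ⟨K, hK, fun p hp a b hab m hm x hx => ?_⟩
  have hh : 0 < b - a := sub_pos.2 hab
  have hx' : a + (b - a) * ((x - a) / (b - a)) = x := by field_simp; ring
  have key := H (p.comp (C a + C (b - a) * X)) ?_ m hm ((x - a) / (b - a)) ?_
  · rw [iterate_derivative_comp_affine] at key
    simp only [eval_mul, eval_C, eval_comp, eval_add, eval_X, hx'] at key
    have hint : ∫ t in (0:ℝ)..1, (1 - t) * p.eval (a + (b - a) * t) ^ 2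
        = (b - a)⁻¹ ^ 2 * ∫ t in a..b, (b - t) * p.eval t ^ 2 := by
      have e := intervalIntegral.integral_comp_add_mul
        (fun t => (b - t) * p.eval t ^ 2) hh.ne' a (a := 0) (b := 1)
      simp only [mul_zero, add_zero, mul_one, add_sub_cancel, smul_eq_mul] at e
      rw [pow_two, mul_assoc, ← e, ← intervalIntegral.integral_const_mul]
      congr 1; ext t
      field_simp
      ring
    rw [hint] at key
    calc _ ≤ (K * ((b - a)⁻¹ ^ 2 * ∫ t in a..b, (b - t) * p.eval t ^ 2)) * (b - a) ^ 2 := by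
          gcongr
      _ = _ := by field_simp
  · refine natDegree_comp_le.trans ?_
    have : (C a + C (b - a) * X : ℝ[X]).natDegree ≤ 1 := by compute_degree
    nlinarith
  · constructor
    · exact div_nonneg (by linarith [hx.1]) hh.le
    · rw [div_le_one hh]; linarith [hx.2]

/-- Inverse inequality on `[a, b]`. -/
lemma exists_inverse_inequality (k : ℕ) : ∃ K : ℝ, 0 < K ∧
    ∀ p : ℝ[X], p.natDegree ≤ k → ∀ a b : ℝ, a < b → ∀ m ≤ k, ∀ x ∈ Set.Icc a b,
      (b - a) ^ m * |(derivative^[m] p).eval x| * √(b - a)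
        ≤ K * √(∫ t in a..b, p.eval t ^ 2) := by
  obtain ⟨K, hK, H⟩ := exists_inverse_inequality_weighted k
  refine ⟨√K, by positivity, fun p hp a b hab m hm x hx => ?_⟩
  have hh : 0 < b - a := sub_pos.2 hab
  have h1 := H p hp a b hab m hm x hx
  have h2 : ∫ t in a..b, (b - t) * p.eval t ^ 2 ≤ (b - a) * ∫ t in a..b, p.eval t ^ 2 := by
    rw [← intervalIntegral.integral_const_mul]
    refine intervalIntegral.integral_mono_on hab.le
      (Continuous.intervalIntegrable (by fun_prop) _ _)
      (Continuous.intervalIntegrable (by fun_prop) _ _) fun t ht => ?_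
    have := ht.1
    gcongr
  rw [← Real.sqrt_mul hK.le]
  apply Real.le_sqrt_of_sq_le
  rw [mul_pow, Real.sq_sqrt hh.le, mul_pow, sq_abs, ← mul_pow]
  refine le_of_mul_le_mul_right ?_ hh
  calc _ = ((b - a) ^ m * (derivative^[m] p).eval x) ^ 2 * (b - a) ^ 2 := by ring
    _ ≤ K * ∫ t in a..b, (b - t) * p.eval t ^ 2 := h1
    _ ≤ K * ((b - a) * ∫ t in a..b, p.eval t ^ 2) := by gcongr
    _ = _ := by ring

lemma sq_integral_le {f : ℝ → ℝ} (hf : Continuous f) {a b : ℝ} (hab : a ≤ b) :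
    (∫ t in a..b, f t) ^ 2 ≤ (b - a) * ∫ t in a..b, f t ^ 2 := by
  rcases hab.eq_or_lt with rfl | hab
  · simp
  have hh : 0 < b - a := sub_pos.2 hab
  set A := ∫ t in a..b, f t with hA
  have h0 : 0 ≤ ∫ t in a..b, (f t - A / (b - a)) ^ 2 :=
    intervalIntegral.integral_nonneg hab.le fun _ _ => sq_nonneg _
  have h1 : ∫ t in a..b, (f t - A / (b - a)) ^ 2
      = (∫ t in a..b, f t ^ 2) - 2 * (A / (b - a)) * A + (A / (b - a)) ^ 2 * (b - a) := by
    rw [hA, ← intervalIntegral.integral_const_mul, ← hA,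
      ← intervalIntegral.integral_sub (Continuous.intervalIntegrable (by fun_prop) _ _)
        (Continuous.intervalIntegrable (by fun_prop) _ _),
      mul_comm ((A / (b - a)) ^ 2), ← smul_eq_mul (b - a), ← intervalIntegral.integral_const,
      ← intervalIntegral.integral_add (Continuous.intervalIntegrable (by fun_prop) _ _)
        (Continuous.intervalIntegrable (by fun_prop) _ _)]
    congr 1; ext t; ring
  rw [h1] at h0
  have h2 := mul_nonneg hh.le h0
  have h3 : (b - a) * ((∫ t in a..b, f t ^ 2) - 2 * (A / (b - a)) * A
      + (A / (b - a)) ^ 2 * (b - a)) = (b - a) * (∫ t in a..b, f t ^ 2) - A ^ 2 := by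
    field_simp; ring
  linarith

lemma abs_iteratedDeriv_le_of_vanishing {k : ℕ} {f : ℝ → ℝ} (hf : ContDiff ℝ (k+1) f)
    {a b : ℝ} (hab : a ≤ b) (hb : ∀ m ≤ k, iteratedDeriv m f b = 0) (d m : ℕ) (hm : m + d = k) :
    ∀ x ∈ Set.Icc a b, |iteratedDeriv m f x|
      ≤ (b - a) ^ d * (√(b - a) * √(∫ t in a..b, iteratedDeriv (k+1) f t ^ 2)) := by
  have hdiff : ∀ i ≤ k, Differentiable ℝ (iteratedDeriv i f) := fun i hi =>
    hf.differentiable_iteratedDeriv i (by exact_mod_cast Nat.lt_succ_of_le hi)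
  have hcont : Continuous (iteratedDeriv (k+1) f) :=
    hf.continuous_iteratedDeriv (k+1) (by exact_mod_cast le_rfl)
  induction d generalizing m with
  | zero =>
    obtain rfl : m = k := by omega
    intro x hx
    have h1 : ∫ t in x..b, iteratedDeriv (m+1) f t = iteratedDeriv m f b - iteratedDeriv m f x := by
      refine intervalIntegral.integral_eq_sub_of_hasDerivAt (fun t _ => ?_)
        (hcont.intervalIntegrable _ _)
      rw [iteratedDeriv_succ]
      exact (hdiff m le_rfl t).hasDerivAt
    rw [hb m le_rfl, zero_sub] at h1
    have h2 := sq_integral_le hcont hx.2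
    rw [h1, neg_sq] at h2
    have h3 : ∫ t in x..b, iteratedDeriv (m+1) f t ^ 2
        ≤ ∫ t in a..b, iteratedDeriv (m+1) f t ^ 2 :=
      intervalIntegral.integral_mono_interval hx.1 hx.2 le_rfl
        (ae_of_all _ fun t => sq_nonneg _) ((hcont.pow 2).intervalIntegrable _ _)
    have h4 : 0 ≤ ∫ t in x..b, iteratedDeriv (m+1) f t ^ 2 :=
      intervalIntegral.integral_nonneg hx.2 fun _ _ => sq_nonneg _
    rw [pow_zero, one_mul, ← Real.sqrt_mul (sub_nonneg.2 hab)]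
    apply Real.abs_le_sqrt
    refine h2.trans ?_
    have := hx.1
    have := sub_nonneg.2 hab
    gcongr
  | succ d ih =>
    intro x hx
    have h1 := (convex_Icc a b).norm_image_sub_le_of_norm_deriv_le (f := iteratedDeriv m f)
      (fun t _ => hdiff m (by omega) t)
      (fun t ht => by
        rw [← iteratedDeriv_succ, Real.norm_eq_abs]
        exact ih (m+1) (by omega) t ht) (Set.right_mem_Icc.2 hab) hx
    rw [hb m (by omega), sub_zero, Real.norm_eq_abs, Real.norm_eq_abs] at h1
    refine h1.trans ?_
    have h2 : |x - b| ≤ b - a := by rw [abs_le]; constructor <;> linarith [hx.1, hx.2]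
    have := sub_nonneg.2 hab
    calc _ ≤ (b - a) ^ d * (√(b - a) * √(∫ t in a..b, iteratedDeriv (k+1) f t ^ 2)) * (b - a) := by
          gcongr
      _ = _ := by ring

lemma exists_polynomial_iterate_derivative_eq (k : ℕ) (b : ℝ) (c : ℕ → ℝ) :
    ∃ T : ℝ[X], T.natDegree ≤ k ∧ ∀ m ≤ k, (derivative^[m] T).eval b = c m := by
  set P : ℝ[X] := ∑ i ∈ range (k+1), C (c i / i.factorial) * X ^ i with hP
  refine ⟨taylor (-b) P, ?_, fun m hm => ?_⟩
  · rw [natDegree_taylor]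
    refine natDegree_sum_le_of_forall_le _ _ fun i hi => ?_
    exact (natDegree_C_mul_X_pow_le _ _).trans (Nat.lt_succ_iff.1 (mem_range.1 hi))
  · rw [← factorial_smul_hasseDeriv, LinearMap.smul_apply, eval_smul, ← taylor_coeff,
      taylor_taylor, add_neg_cancel, taylor_zero, hP, finsetSum_coeff]
    simp [coeff_X_pow, hm]
    field_simp

lemma iteratedDeriv_polynomial (p : ℝ[X]) (m : ℕ) :
    iteratedDeriv m (fun x => p.eval x) = fun x => (derivative^[m] p).eval x := by
  induction m with
  | zero => simp
  | succ m ih =>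
    rw [iteratedDeriv_succ, ih, Function.iterate_succ_apply']
    ext x
    exact Polynomial.deriv _

/-- Approximation property of the Gauss–Radau projection. -/
lemma exists_gaussRadau_error_bound (k : ℕ) : ∃ K : ℝ, 0 < K ∧
    ∀ U : ℝ → ℝ, ContDiff ℝ (k+1) U → ∀ a b : ℝ, a < b → ∀ p : ℝ[X], IsGRProj k a b U p →
      ∀ m ≤ k, ∀ x ∈ Set.Icc a b,
        (b - a) ^ m * |(derivative^[m] p).eval x - iteratedDeriv m U x|
          ≤ K * ((b - a) ^ k * (√(b - a) * √(∫ t in a..b, iteratedDeriv (k+1) U t ^ 2))) := by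
  obtain ⟨K, hK, H⟩ := exists_inverse_inequality_weighted k
  refine ⟨K * K + K + 1, by positivity, fun U hU a b hab p hp m hm x hx => ?_⟩
  have hh : 0 < b - a := sub_pos.2 hab
  obtain ⟨hpdeg, hporth, hpb⟩ := hp
  obtain ⟨T, hTdeg, hT⟩ := exists_polynomial_iterate_derivative_eq k b (fun m => iteratedDeriv m U b)
  set R : ℝ → ℝ := fun t => U t - T.eval t with hR
  have hTs : ContDiff ℝ (k+1) (fun t => T.eval t) := by
    simpa using T.contDiff_aeval (𝕜 := ℝ) (k+1)
  have hRs : ContDiff ℝ (k+1) R := hU.sub hTs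
  have hRd : ∀ m ≤ k + 1, ∀ t, iteratedDeriv m R t
      = iteratedDeriv m U t - (derivative^[m] T).eval t := by
    intro m hm t
    have hm' : (m : WithTop ℕ∞) ≤ k + 1 := by exact_mod_cast hm
    rw [hR, iteratedDeriv_fun_sub (hU.of_le hm').contDiffAt (hTs.of_le hm').contDiffAt,
      iteratedDeriv_polynomial]
  have hRk : iteratedDeriv (k+1) R = iteratedDeriv (k+1) U := by
    ext t
    rw [hRd _ le_rfl, iterate_derivative_eq_zero (Nat.lt_succ_of_le hTdeg)]
    simp
  have hRb : ∀ m ≤ k, iteratedDeriv m R b = 0 := fun m hm => by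
    rw [hRd m (by omega), hT m hm, sub_self]
  set E := √(b - a) * √(∫ t in a..b, iteratedDeriv (k+1) U t ^ 2) with hE
  have hE0 : 0 ≤ E := by positivity
  have hRbd : ∀ m ≤ k, ∀ t ∈ Set.Icc a b, (b - a) ^ m * |iteratedDeriv m R t| ≤ (b - a) ^ k * E := by
    intro m hm t ht
    have := abs_iteratedDeriv_le_of_vanishing hRs hab.le hRb (k - m) m (by omega) t ht
    rw [hRk, ← hE] at this
    calc _ ≤ (b - a) ^ m * ((b - a) ^ (k - m) * E) := by gcongr
      _ = _ := by rw [← mul_assoc, ← pow_add, Nat.add_sub_cancel' hm]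
  set M := (b - a) ^ k * E with hM
  have hM0 : 0 ≤ M := by positivity
  have hRM : ∀ t ∈ Set.Icc a b, |R t| ≤ M := fun t ht => by simpa using hRbd 0 (by omega) t ht
  set q := p - T with hq
  have hqdeg : q.natDegree ≤ k := (natDegree_sub_le _ _).trans (max_le hpdeg hTdeg)
  have hqb : q.eval b = 0 := by
    have := hT 0 (by omega)
    simp at this
    simp [hq, hpb, this]
  obtain ⟨s, hs⟩ := dvd_iff_isRoot.2 hqb
  have hqM : ∀ t ∈ Set.Icc a b, |q.eval t| ≤ K * M := by
    rcases eq_or_ne s 0 with rfl | hs0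
    · intro t _
      simp only [hs, mul_zero, eval_zero, abs_zero]
      positivity
    have hsdeg : s.natDegree < k := by
      rw [hs, natDegree_mul (X_sub_C_ne_zero b) hs0, natDegree_X_sub_C] at hqdeg
      omega
    obtain ⟨y, hy, hmax⟩ := isCompact_Icc.exists_isMaxOn (Set.nonempty_Icc.2 hab.le)
      (s.continuous.abs.continuousOn (s := Set.Icc a b))
    set S := |s.eval y| with hS
    have hUc : Continuous U := hU.continuous
    have hRc : Continuous R := hRs.continuous
    have horth := hporth s hsdeg
    have hw : ∫ t in a..b, (b - t) * s.eval t ^ 2 ≤ M * S * (b - a) := by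
      have e : ∫ t in a..b, (b - t) * s.eval t ^ 2 = ∫ t in a..b, - (R t * s.eval t) := by
        rw [← sub_eq_zero, ← intervalIntegral.integral_sub
          (Continuous.intervalIntegrable (by fun_prop) _ _)
          (Continuous.intervalIntegrable (by fun_prop) _ _), ← horth]
        congr 1; ext t
        have : p.eval t = T.eval t + (t - b) * s.eval t := by
          have := congrArg (eval t) hs
          simp [hq] at this
          linarith
        rw [this, hR]; ring
      rw [e]
      have hc : ∫ _ in a..b, M * S = M * S * (b - a) := by
        rw [intervalIntegral.integral_const, smul_eq_mul, mul_comm]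
      rw [← hc]
      refine intervalIntegral.integral_mono_on hab.le
        (Continuous.intervalIntegrable (by fun_prop) _ _)
        (Continuous.intervalIntegrable (by fun_prop) _ _) fun t ht => ?_
      refine (neg_le_abs _).trans ?_
      rw [abs_mul]
      exact mul_le_mul (hRM t ht) (hmax ht) (abs_nonneg _) hM0
    have h1 := H s hsdeg.le a b hab 0 (by omega) y hy
    simp only [pow_zero, one_mul, Function.iterate_zero, id_eq] at h1
    have h2 : S * (b - a) ≤ K * M := by
      rcases (abs_nonneg (s.eval y)).eq_or_lt with h0 | h0
      · rw [hS, ← h0]; simp; positivity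
      rw [← hS] at h0
      rw [← sq_abs, ← hS] at h1
      refine le_of_mul_le_mul_right ?_ (mul_pos h0 hh)
      calc _ = S ^ 2 * (b - a) ^ 2 := by ring
        _ ≤ _ := h1
        _ ≤ K * (M * S * (b - a)) := by gcongr
        _ = _ := by ring
    intro t ht
    rw [hs, eval_mul, abs_mul]
    have h3 : |(X - C b : ℝ[X]).eval t| ≤ b - a := by
      simp only [eval_sub, eval_X, eval_C]
      rw [abs_le]; constructor <;> linarith [ht.1, ht.2]
    have h4 : |s.eval t| ≤ S := hmax ht
    calc _ ≤ (b - a) * S := by gcongr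
      _ ≤ _ := by linarith
  have hqm : (b - a) ^ m * |(derivative^[m] q).eval x| ≤ (K * K + K) * M := by
    have h1 := H q hqdeg a b hab m hm x hx
    have h2 : ∫ t in a..b, (b - t) * q.eval t ^ 2 ≤ (b - a) * (K * M) ^ 2 * (b - a) := by
      have hc : ∫ _ in a..b, (b - a) * (K * M) ^ 2 = (b - a) * (K * M) ^ 2 * (b - a) := by
        rw [intervalIntegral.integral_const, smul_eq_mul, mul_comm]
      rw [← hc]
      refine intervalIntegral.integral_mono_on hab.le
        (Continuous.intervalIntegrable (by fun_prop) _ _)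
        (Continuous.intervalIntegrable (by fun_prop) _ _) fun t ht => ?_
      have h3 : q.eval t ^ 2 ≤ (K * M) ^ 2 := by
        rw [← sq_abs]; gcongr; exact hqM t ht
      have := ht.1
      gcongr
    have h3 : ((b - a) ^ m * (derivative^[m] q).eval x) ^ 2 ≤ K * (K * M) ^ 2 := by
      refine le_of_mul_le_mul_right (h1.trans ?_) (pow_pos hh 2)
      calc _ ≤ K * ((b - a) * (K * M) ^ 2 * (b - a)) := by gcongr
        _ = _ := by ring
    have h4 := Real.abs_le_sqrt h3
    rw [abs_mul, abs_of_pos (pow_pos hh m)] at h4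
    refine h4.trans (Real.sqrt_le_iff.2 ⟨by positivity, ?_⟩)
    have : K * (K * M) ^ 2 ≤ (K * K + K) ^ 2 * M ^ 2 := by
      have : K ^ 3 ≤ (K * K + K) ^ 2 := by nlinarith [pow_pos hK 2, pow_pos hK 3, pow_pos hK 4]
      calc _ = K ^ 3 * M ^ 2 := by ring
        _ ≤ _ := by gcongr
    linarith [mul_pow (K * K + K) M 2]
  have hsplit : (derivative^[m] p).eval x - iteratedDeriv m U x
      = (derivative^[m] q).eval x - iteratedDeriv m R x := by
    rw [hRd m (by omega), hq, iterate_derivative_sub, eval_sub]; ring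
  rw [hsplit]
  calc _ ≤ (b - a) ^ m * (|(derivative^[m] q).eval x| + |iteratedDeriv m R x|) := by
        gcongr; exact abs_sub _ _
    _ = (b - a) ^ m * |(derivative^[m] q).eval x| + (b - a) ^ m * |iteratedDeriv m R x| := by ring
    _ ≤ (K * K + K) * M + M := add_le_add hqm (hRbd m hm x hx)
    _ = _ := by ring

lemma IsMesh.cellh_pos {pt : Fin (N+1) → ℝ} (h : IsMesh pt) (j : Fin N) : 0 < cellh pt j :=
  sub_pos.2 (h.2.2 (Fin.castSucc_lt_succ (i := j)))

lemma cellh_le_meshSize (pt : Fin (N+1) → ℝ) (j : Fin N) : cellh pt j ≤ meshSize pt :=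
  le_ciSup (f := fun j => cellh pt j) (Set.finite_range _).bddAbove j

/-- A periodic function takes the same value at the two identified copies of an interface. -/
lemma IsMesh.periodic_interface_eq [NeZero N] {pt : Fin (N+1) → ℝ} (h : IsMesh pt) {f : ℝ → ℝ}
    (hf : Function.Periodic f 1) (j : Fin N) :
    f (ptL pt (j+1)) = f (ptR pt j) := by
  obtain ⟨n, rfl⟩ : ∃ n, N = n + 1 := Nat.exists_eq_succ_of_ne_zero (NeZero.ne N)
  rcases eq_or_ne j (Fin.last n) with rfl | hj
  · have h1 : ptL pt (Fin.last n + 1) = 0 := by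
      rw [ptL, Fin.last_add_one]; exact h.1
    have h2 : ptR pt (Fin.last n) = 1 := by
      rw [ptR, Fin.succ_last]; exact h.2.1
    rw [h1, h2]
    simpa using (hf 0).symm
  · congr 1
    rw [ptL, ptR]
    congr 1
    ext
    rw [Fin.val_castSucc, Fin.val_add_one_of_lt (Fin.lt_last_iff_ne_last.2 hj), Fin.val_succ]

/-- Pointwise bound on a cell for the error `∂ᵐ(u - U)`. -/
lemma exists_cell_error_bound (k : ℕ) : ∃ K : ℝ, 0 < K ∧
    ∀ U : ℝ → ℝ, ContDiff ℝ (k+1) U → ∀ a b : ℝ, a < b → ∀ u p : ℝ[X], u.natDegree ≤ k →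
      IsGRProj k a b U p → ∀ m ≤ k, ∀ x ∈ Set.Icc a b,
        (b - a) ^ m * |(derivative^[m] u).eval x - iteratedDeriv m U x|
          ≤ K * (√(∫ t in a..b, (u - p).eval t ^ 2) / √(b - a)
            + (b - a) ^ k * (√(b - a) * √(∫ t in a..b, iteratedDeriv (k+1) U t ^ 2))) := by
  obtain ⟨K₁, hK₁, H₁⟩ := exists_inverse_inequality k
  obtain ⟨K₂, hK₂, H₂⟩ := exists_gaussRadau_error_bound k
  refine ⟨K₁ + K₂, by positivity, fun U hU a b hab u p hu hp m hm x hx => ?_⟩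
  have hh : 0 < b - a := sub_pos.2 hab
  have h₁ := H₁ (u - p) ((natDegree_sub_le _ _).trans (max_le hu hp.1)) a b hab m hm x hx
  rw [← le_div_iff₀ (Real.sqrt_pos.2 hh), mul_div_assoc] at h₁
  have h₂ := H₂ U hU a b hab p hp m hm x hx
  set X := √(∫ t in a..b, (u - p).eval t ^ 2) / √(b - a)
  set Y := (b - a) ^ k * (√(b - a) * √(∫ t in a..b, iteratedDeriv (k+1) U t ^ 2))
  have hX : 0 ≤ X := by positivity
  have hY : 0 ≤ Y := by positivity
  have hsplit : (derivative^[m] u).eval x - iteratedDeriv m U x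
      = (derivative^[m] (u - p)).eval x + ((derivative^[m] p).eval x - iteratedDeriv m U x) := by
    rw [iterate_derivative_sub, eval_sub]; ring
  rw [hsplit]
  calc _ ≤ (b - a) ^ m * (|(derivative^[m] (u - p)).eval x|
          + |(derivative^[m] p).eval x - iteratedDeriv m U x|) := by
        gcongr; exact abs_add_le _ _
    _ ≤ K₁ * X + K₂ * Y := by rw [mul_add]; exact add_le_add h₁ h₂
    _ ≤ _ := by nlinarith [mul_nonneg hK₁.le hY, mul_nonneg hK₂.le hX]

/-- Lemma 4.6, 1D case, `d = 1`.  Let `u_h ∈ V^k`, `U` a `C^{k+1}`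
periodic function, `ξ = u_h - P*U`.  If `‖u_h - avg(u_h)‖_{L∞} ≥ c₀ > 0` and
`0 ≤ β_j ≤ β_max`, then there is `C = C(k, c₀, β_max, γ)` such that the damping rates
`δ_j^m = β_j σ_j^m(u_h)/h_j` satisfy, for all `j` and `0 ≤ m ≤ k`,
`|δ_j^m| ≤ C (h^{-3/2} ‖ξ‖_{L²(N_j)} + h^{k-1/2} ‖U‖_{H^{k+1}(N_j)})`,
where `N_j = I_{j-1} ∪ I_j ∪ I_{j+1}`. -/
theorem dampRate_estimate
    (k : ℕ) (c0 βmax γ : ℝ) (hc0 : 0 < c0) (hβmax : 0 ≤ βmax) (hγ : 1 ≤ γ) :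
    ∃ C : ℝ, 0 < C ∧
      ∀ (N : ℕ) [NeZero N] (pt : Fin (N+1) → ℝ),
        IsMesh pt → QuasiUniform pt γ →
      ∀ U : ℝ → ℝ, ContDiff ℝ (k+1) U → Function.Periodic U 1 →
      ∀ uh : Fin N → Polynomial ℝ, MemVk k uh →
      ∀ PU : Fin N → Polynomial ℝ,
        (∀ j, IsGRProj k (ptL pt j) (ptR pt j) U (PU j)) →
      ∀ β : Fin N → ℝ, (∀ j, 0 ≤ β j ∧ β j ≤ βmax) →
      c0 ≤ linfSub pt uh (avg pt uh) →
      ∀ (j : Fin N) (m : ℕ), m ≤ k →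
        |dampRate k pt β uh m j|
          ≤ C * (meshSize pt ^ (-(3:ℝ)/2)
                * Real.sqrt (∑ i ∈ ({j-1, j, j+1} : Finset (Fin N)),
                    cip pt i (uh i - PU i) (uh i - PU i))
              + meshSize pt ^ ((k:ℝ) - 1/2)
                * Real.sqrt (∑ i ∈ ({j-1, j, j+1} : Finset (Fin N)),
                    ∑ m' ∈ Finset.range (k+2),
                      ∫ x in (ptL pt i)..(ptR pt i), (iteratedDeriv m' U x)^2)) := by
  obtain ⟨K, hK, H⟩ := exists_cell_error_bound k
  set K' := γ ^ k * K * γ with hK'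
  have hγ0 : 0 < γ := by linarith
  have hK'0 : 0 < K' := by positivity
  refine ⟨βmax * γ * ((2 * k + 1) * (4 * K' / (2 * c0))) + 1, by positivity, ?_⟩
  intro N _ pt hpt hqu U hU hper uh huh PU hPU β hβ hlinf j m hm
  set h := meshSize pt with hh
  have hcell := hpt.cellh_pos
  have hcellh : ∀ i, cellh pt i ≤ h := cellh_le_meshSize pt
  have hh0 : 0 < h := (hcell j).trans_le (hcellh j)
  set s : Finset (Fin N) := {j-1, j, j+1} with hs
  set A := √(∑ i ∈ s, cip pt i (uh i - PU i) (uh i - PU i)) with hA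
  set B := √(∑ i ∈ s, ∑ m' ∈ Finset.range (k+2),
    ∫ x in (ptL pt i)..(ptR pt i), (iteratedDeriv m' U x)^2) with hB
  have hle : ∀ i, ptL pt i ≤ ptR pt i := fun i => (sub_pos.1 (hcell i)).le
  have hAi : ∀ i ∈ s, √(∫ t in (ptL pt i)..(ptR pt i), (uh i - PU i).eval t ^ 2) ≤ A := by
    intro i hi
    apply Real.sqrt_le_sqrt
    have e : ∀ i, cip pt i (uh i - PU i) (uh i - PU i)
        = ∫ t in (ptL pt i)..(ptR pt i), (uh i - PU i).eval t ^ 2 := fun i => by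
      simp only [cip, pow_two]
    rw [← e]
    refine single_le_sum (f := fun i => cip pt i (uh i - PU i) (uh i - PU i)) (fun i _ => ?_) hi
    rw [e]
    exact intervalIntegral.integral_nonneg (hle i) fun _ _ => sq_nonneg _
  have hBi : ∀ i ∈ s, √(∫ t in (ptL pt i)..(ptR pt i), iteratedDeriv (k+1) U t ^ 2) ≤ B := by
    intro i hi
    apply Real.sqrt_le_sqrt
    have h0 : ∀ i m', 0 ≤ ∫ x in (ptL pt i)..(ptR pt i), (iteratedDeriv m' U x)^2 := fun i m' =>
      intervalIntegral.integral_nonneg (hle i) fun _ _ => sq_nonneg _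
    refine le_trans ?_ (single_le_sum (f := fun i => ∑ m' ∈ Finset.range (k+2),
      ∫ x in (ptL pt i)..(ptR pt i), (iteratedDeriv m' U x)^2)
      (fun i _ => sum_nonneg fun m' _ => h0 i m') hi)
    exact single_le_sum (f := fun m' => ∫ x in (ptL pt i)..(ptR pt i), (iteratedDeriv m' U x)^2)
      (fun m' _ => h0 i m') (mem_range.2 (by omega))
  have hA0 : 0 ≤ A := Real.sqrt_nonneg _
  have hB0 : 0 ≤ B := Real.sqrt_nonneg _
  set G := A / √h + h ^ k * (√h * B) with hG
  have hG0 : 0 ≤ G := by positivity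
  have hpoint : ∀ i ∈ s, ∀ x ∈ Set.Icc (ptL pt i) (ptR pt i),
      h ^ m * |(pderiv m (uh i)).eval x - iteratedDeriv m U x| ≤ K' * G := by
    intro i hi x hx
    have hci := hcell i
    have h1 : cellh pt i ^ m * |(pderiv m (uh i)).eval x - iteratedDeriv m U x| ≤ _ :=
      H U hU _ _ (sub_pos.1 hci) (uh i) (PU i) (huh i) (hPU i) m hm x hx
    change _ ≤ K * (_ / √(cellh pt i) + cellh pt i ^ k * (√(cellh pt i) * _)) at h1
    have h2 : h ^ m ≤ γ ^ k * cellh pt i ^ m := by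
      calc h ^ m ≤ (γ * cellh pt i) ^ m := by gcongr; exact hqu i
        _ = γ ^ m * cellh pt i ^ m := mul_pow _ _ _
        _ ≤ _ := by gcongr
    have h3 : √h ≤ γ * √(cellh pt i) := by
      rw [← Real.sqrt_sq hγ0.le, ← Real.sqrt_mul (sq_nonneg γ)]
      apply Real.sqrt_le_sqrt
      nlinarith [hqu i, mul_pos hγ0 hci]
    have h4 : A / √(cellh pt i) ≤ γ * (A / √h) := by
      rw [← mul_div_assoc, div_le_div_iff₀ (Real.sqrt_pos.2 hci) (Real.sqrt_pos.2 hh0)]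
      calc _ ≤ A * (γ * √(cellh pt i)) := by gcongr
        _ = _ := by ring
    have h5 : cellh pt i ^ k * (√(cellh pt i) * B) ≤ γ * (h ^ k * (√h * B)) := by
      calc _ ≤ h ^ k * (√h * B) := by
            have := hcellh i
            gcongr
        _ ≤ _ := le_mul_of_one_le_left (by positivity) hγ
    have hAi' := hAi i hi
    have hBi' := hBi i hi
    calc _ ≤ (γ ^ k * cellh pt i ^ m) * |(pderiv m (uh i)).eval x - iteratedDeriv m U x| := by
          gcongr
      _ = γ ^ k * (cellh pt i ^ m * |(pderiv m (uh i)).eval x - iteratedDeriv m U x|) := by ring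
      _ ≤ γ ^ k * (K * (A / √(cellh pt i) + cellh pt i ^ k * (√(cellh pt i) * B))) := by
          refine mul_le_mul_of_nonneg_left (h1.trans ?_) (by positivity)
          gcongr
      _ ≤ γ ^ k * (K * (γ * (A / √h) + γ * (h ^ k * (√h * B)))) := by gcongr
      _ = K' * G := by rw [hK', hG]; ring
  have hperm : Function.Periodic (iteratedDeriv m U) 1 := by
    intro x
    have : (fun z => U (z + 1)) = U := funext hper
    conv_rhs => rw [← this]
    rw [iteratedDeriv_comp_add_const]
  have hjump : ∀ i, i ∈ s → i + 1 ∈ s → h ^ m * |jumpD pt uh m i| ≤ 2 * (K' * G) := by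
    intro i hi hi'
    have h1 := hpoint i hi (ptR pt i) (Set.right_mem_Icc.2 (hle i))
    have h2 := hpoint (i+1) hi' (ptL pt (i+1)) (Set.left_mem_Icc.2 (hle _))
    rw [hpt.periodic_interface_eq hperm] at h2
    have e : jumpD pt uh m i
        = ((pderiv m (uh (i+1))).eval (ptL pt (i+1)) - iteratedDeriv m U (ptR pt i))
          - ((pderiv m (uh i)).eval (ptR pt i) - iteratedDeriv m U (ptR pt i)) := by
      simp only [jumpD, ptL, ptR]; ring
    rw [e]
    calc _ ≤ h ^ m * (|(pderiv m (uh (i+1))).eval (ptL pt (i+1)) - iteratedDeriv m U (ptR pt i)|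
          + |(pderiv m (uh i)).eval (ptR pt i) - iteratedDeriv m U (ptR pt i)|) := by
          gcongr; exact abs_sub _ _
      _ ≤ _ := by linarith
  have hj1 := hjump (j-1) (by simp [hs]) (by simp [hs])
  have hj2 := hjump j (by simp [hs]) (by simp [hs])
  have hsigma : |sigma k pt uh m j| ≤ (2 * k + 1) * (4 * K' / (2 * c0)) * G := by
    rw [sigma]
    split_ifs
    · rw [abs_zero]; positivity
    have hl0 := hc0.trans_le hlinf
    have hcj := hcell j
    have hk1 : 1 ≤ |2 * (k:ℝ) - 1| := by
      rcases Nat.eq_zero_or_pos k with rfl | hk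
      · norm_num
      · have : (1:ℝ) ≤ k := by exact_mod_cast hk
        rw [abs_of_pos] <;> linarith
    have hm1 : (1:ℝ) ≤ m.factorial := by exact_mod_cast m.factorial_pos
    have hden : 1 ≤ |2 * (k:ℝ) - 1| * m.factorial := by nlinarith
    set J := |jumpD pt uh m (j-1)| + |jumpD pt uh m j| with hJ
    have hJ0 : 0 ≤ J := by positivity
    have hmk : (m:ℝ) ≤ k := by exact_mod_cast hm
    rw [abs_mul, abs_div, abs_mul (2 * (k:ℝ) - 1), Nat.abs_cast,
      abs_of_nonneg (a := (2 * (m:ℝ) + 1) * cellh pt j ^ m) (by positivity),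
      abs_of_nonneg (a := J / (2 * linfSub pt uh (avg pt uh))) (by positivity)]
    have hhJ : h ^ m * J ≤ 4 * K' * G := by rw [hJ]; linarith
    have hcjh := hcellh j
    calc _ ≤ ((2 * (m:ℝ) + 1) * cellh pt j ^ m) * (J / (2 * c0)) := by
          gcongr
          exact div_le_self (by positivity) hden
      _ ≤ ((2 * (k:ℝ) + 1) * h ^ m) * (J / (2 * c0)) := by gcongr
      _ = (2 * (k:ℝ) + 1) * ((h ^ m * J) / (2 * c0)) := by ring
      _ ≤ (2 * (k:ℝ) + 1) * ((4 * K' * G) / (2 * c0)) := by gcongr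
      _ = _ := by ring
  have hrate : h ^ (-(3:ℝ)/2) * A + h ^ ((k:ℝ) - 1/2) * B = G / h := by
    have e1 : h ^ (-(3:ℝ)/2) = 1 / (h * √h) := by
      rw [show -(3:ℝ)/2 = -(1 + 1/2) by norm_num, Real.rpow_neg hh0.le, Real.rpow_add hh0,
        Real.rpow_one, ← Real.sqrt_eq_rpow, one_div]
    have e2 : h ^ ((k:ℝ) - 1/2) = h ^ k * √h / h := by
      rw [show (k:ℝ) - 1/2 = k + 1/2 - 1 by ring, Real.rpow_sub hh0, Real.rpow_add hh0,
        Real.rpow_one, ← Real.sqrt_eq_rpow, Real.rpow_natCast]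
    have := Real.sqrt_pos.2 hh0
    rw [e1, e2, hG]
    field_simp
  rw [hrate, dampRate, abs_div, abs_mul, abs_of_nonneg (hβ j).1, abs_of_pos (hcell j)]
  have hinv : 1 / cellh pt j ≤ γ / h := by
    rw [div_le_div_iff₀ (hcell j) hh0, one_mul]
    exact hqu j
  have hβj := (hβ j).2
  calc _ = β j * |sigma k pt uh m j| * (1 / cellh pt j) := by ring
    _ ≤ βmax * ((2 * k + 1) * (4 * K' / (2 * c0)) * G) * (γ / h) := by
        have := hcell j
        gcongr
    _ = βmax * γ * ((2 * k + 1) * (4 * K' / (2 * c0))) * (G / h) := by ring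
    _ ≤ _ := by
        rw [add_one_mul]
        have : 0 ≤ G / h := by positivity
        linarith
end OEDG
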